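/- arXiv:cs/0202022 — 2 statements merged into one kernel-verified Lean document; each statement's English description precedes it below -/
import Mathlib

section
/- The preference relation ≺ between rational consequence relations is irreflexive and transitive (a strict partial order). -/
/-- Propositional formulas over a set `V` of propositional variables. -/
inductive Fm (V : Type) : Type
  | var : V → Fm V
  | fls : Fm V
  | tru : Fm V
  | neg : Fm V → Fm V
  | conj : Fm V → Fm V → Fm V
  | disj : Fm V → Fm V → Fm V
  | impl : Fm V → Fm V → Fm V
  | iff : Fm V → Fm V → Fm V

variable {V : Type}

/-- Truth value of a formula in a world (truth assignment). -/
def Fm.eval (w : V → Bool) : Fm V → Bool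
  | .var v => w v
  | .fls => false
  | .tru => true
  | .neg a => !(a.eval w)
  | .conj a b => a.eval w && b.eval w
  | .disj a b => a.eval w || b.eval w
  | .impl a b => !(a.eval w) || b.eval w
  | .iff a b => a.eval w == b.eval w

/-- A formula is valid iff it is satisfied by every world. -/
def Valid (a : Fm V) : Prop := ∀ w : V → Bool, a.eval w = true

/-- A conditional "relation": a set of conditional assertions (pairs of formulas). -/
abbrev CRel (V : Type) := Set (Fm V × Fm V)

/-- Preferential consequence relation: Reflexivity, Left Logical Equivalence,
Right Weakening, And, Or, Cautious Monotonicity. -/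
def IsPreferential (K : CRel V) : Prop :=
  (∀ a, (a, a) ∈ K) ∧
  (∀ a b c, Valid (a.iff b) → (a, c) ∈ K → (b, c) ∈ K) ∧
  (∀ a b c, Valid (a.impl b) → (c, a) ∈ K → (c, b) ∈ K) ∧
  (∀ a b c, (a, b) ∈ K → (a, c) ∈ K → (a, b.conj c) ∈ K) ∧
  (∀ a b c, (a, c) ∈ K → (b, c) ∈ K → (a.disj b, c) ∈ K) ∧
  (∀ a b c, (a, b) ∈ K → (a, c) ∈ K → (a.conj b, c) ∈ K)

/-- Rational Monotonicity: if α∧β |~/ γ and α |~/ ¬β then α |~/ γ. -/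
def RationalMonotonicity (K : CRel V) : Prop :=
  ∀ a b c, (a.conj b, c) ∉ K → (a, b.neg) ∉ K → (a, c) ∉ K

/-- A rational consequence relation is a preferential one satisfying Rational
Monotonicity. -/
def IsRational (K : CRel V) : Prop := IsPreferential K ∧ RationalMonotonicity K

/-- Disjunctive Rationality: if α |~/ γ and β |~/ γ then α∨β |~/ γ. -/
def DisjunctiveRationality (K : CRel V) : Prop :=
  ∀ a b c, (a, c) ∉ K → (b, c) ∉ K → (a.disj b, c) ∉ K

/-- Negation Rationality: if α∧γ |~/ β and α∧¬γ |~/ β then α |~/ β. -/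
def NegationRationality (K : CRel V) : Prop :=
  ∀ a b c, (a.conj c, b) ∉ K → (a.conj c.neg, b) ∉ K → (a, b) ∉ K

/-- `s` is minimal in `A` with respect to the strict order `lt`. -/
def MinIn {S : Type} (lt : S → S → Prop) (A : Set S) (s : S) : Prop :=
  s ∈ A ∧ ∀ t ∈ A, ¬ lt t s

/-- A preferential model: states, labeling by worlds, a strict partial order
satisfying the smoothness condition for each formula. -/
structure PrefModel (V : Type) where
  S : Type
  l : S → V → Bool
  lt : S → S → Prop
  irrefl : ∀ s, ¬ lt s s
  trans : ∀ s t u, lt s t → lt t u → lt s u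
  smooth : ∀ (a : Fm V) (s : S), a.eval (l s) = true →
    MinIn lt {t | a.eval (l t) = true} s ∨
    ∃ t, MinIn lt {t | a.eval (l t) = true} t ∧ lt t s

/-- The model `W` satisfies α |~ β iff every state minimal in α̂ satisfies β. -/
def PrefModel.Sat (W : PrefModel V) (a b : Fm V) : Prop :=
  ∀ s, MinIn W.lt {t | a.eval (W.l t) = true} s → b.eval (W.l s) = true

/-- The consequence relation defined by a preferential model. -/
def PrefModel.Rel (W : PrefModel V) : CRel V := {p | W.Sat p.1 p.2}

/-- `W` is a model of the knowledge base `K`. -/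
def PrefModel.Models (W : PrefModel V) (K : CRel V) : Prop := ∀ p ∈ K, W.Sat p.1 p.2

/-- Preferential entailment: `A` is satisfied by every preferential model of `K`. -/
def Entails (K : CRel V) (A : Fm V × Fm V) : Prop :=
  ∀ W : PrefModel V, W.Models K → W.Sat A.1 A.2

/-- The preferential closure of a knowledge base. -/
def PrefClosure (K : CRel V) : CRel V := {A | Entails K A}

/-- A model is well-founded iff it has no infinite descending chain of states. -/
def PrefModel.NoInfDesc (W : PrefModel V) : Prop :=
  ¬ ∃ f : ℕ → W.S, ∀ n, W.lt (f (n + 1)) (f n)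

/-- A ranked model: the strict order is given by a ranking function into a
totally ordered set. -/
def PrefModel.Ranked (W : PrefModel V) : Prop :=
  ∃ (Ω : Type) (_ : LinearOrder Ω) (r : W.S → Ω), ∀ s t, W.lt s t ↔ r s < r t

/-- α is exceptional for K iff K preferentially entails true |~ ¬α. -/
def Exceptional (K : CRel V) (a : Fm V) : Prop := Entails K (Fm.tru, a.neg)

/-- The set of assertions of K whose antecedent is exceptional for K. -/
def ESet (K : CRel V) : CRel V := {p ∈ K | Exceptional K p.1}

/-- The exceptionality hierarchy: C₀ = K, C_{τ+1} = E(C_τ), intersections at limits. -/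
noncomputable def Cseq (K : CRel V) : Ordinal.{0} → CRel V := fun τ =>
  Ordinal.limitRecOn τ K (fun _ C => ESet C)
    (fun o _ ih => ⋂ ρ : Set.Iio o, ih ρ.1 ρ.2)

/-- α has a rank for K iff it is not exceptional for some C_τ. -/
def HasRank (K : CRel V) (a : Fm V) : Prop := ∃ τ : Ordinal.{0}, ¬ Exceptional (Cseq K τ) a

/-- The rank of α for K: the least τ such that α is not exceptional for C_τ. -/
noncomputable def rnk (K : CRel V) (a : Fm V) : Ordinal.{0} :=
  sInf {τ : Ordinal.{0} | ¬ Exceptional (Cseq K τ) a}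

/-- K is admissible iff every formula with no rank is inconsistent for K. -/
def Admissible (K : CRel V) : Prop :=
  ∀ a : Fm V, ¬ HasRank K a → Entails K (a, Fm.fls)

/-- `α < β in K`: the assertion α∨β |~ ¬β belongs to K. -/
def ltIn (K : CRel V) (a b : Fm V) : Prop := (a.disj b, b.neg) ∈ K

/-- K₀ is preferable to K₁. -/
def Pref (K0 K1 : CRel V) : Prop :=
  (∃ a b, (a, b) ∈ K1 \ K0 ∧
    ∀ c, ltIn K0 c a → ∀ d, (c, d) ∈ K0 → (c, d) ∈ K1) ∧
  (∀ c d, (c, d) ∈ K0 \ K1 → ∃ r e, (r, e) ∈ K1 \ K0 ∧ ltIn K1 r c)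

/-- C is the rational closure of K: a rational extension of K preferable to
every other rational extension of K. -/
def IsRationalClosure (K C : CRel V) : Prop :=
  IsRational C ∧ K ⊆ C ∧ ∀ C', IsRational C' → K ⊆ C' → C' ≠ C → Pref C C'

/-- An assertion α |~ β is supported by K^p iff there is γ with α ⊨ γ and
γ |~ β ∈ K^p. -/
def Supported (K : CRel V) (A : Fm V × Fm V) : Prop :=
  ∃ c : Fm V, Valid (A.1.impl c) ∧ (c, A.2) ∈ PrefClosure K

/-- Classical entailment from the material counterpart of a knowledge base. -/
def MatEntails (K : CRel V) (a : Fm V) : Prop :=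
  ∀ w : V → Bool, (∀ p ∈ K, (p.1.impl p.2).eval w = true) → a.eval w = true

namespace IsPreferential

variable {K : CRel V} {a b c x y z : Fm V}

theorem right_weakening (h : IsPreferential K) (hac : (c, a) ∈ K)
    (hab : ∀ w, a.eval w = true → b.eval w = true) : (c, b) ∈ K := by
  refine h.2.2.1 a b c (fun w => ?_) hac
  have := hab w
  simp only [Fm.eval]
  cases h1 : a.eval w <;> simp_all

theorem left_equiv (h : IsPreferential K) (hac : (a, c) ∈ K)
    (hab : ∀ w, a.eval w = true ↔ b.eval w = true) : (b, c) ∈ K := by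
  refine h.2.1 a b c (fun w => ?_) hac
  have := hab w
  simp only [Fm.eval]
  cases h1 : a.eval w <;> simp_all

theorem of_entails (h : IsPreferential K)
    (hab : ∀ w, a.eval w = true → b.eval w = true) : (a, b) ∈ K :=
  h.right_weakening (h.1 a) hab

theorem cautious_left (h : IsPreferential K) (hab : (a, b) ∈ K) (hac : (a, c) ∈ K)
    (hx : ∀ w, x.eval w = true ↔ a.eval w = true ∧ b.eval w = true) : (x, c) ∈ K :=
  h.left_equiv (h.2.2.2.2.2 a b c hab hac) (fun w => by simp [Fm.eval, hx w])

theorem ltIn_mono_left (h : IsPreferential K) (hxy : ltIn K x y)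
    (hxz : ∀ w, x.eval w = true → z.eval w = true) : ltIn K z y := by
  have h1 : (z.conj y.neg, y.neg) ∈ K := h.of_entails (fun w => by simp [Fm.eval])
  refine h.left_equiv (h.2.2.2.2.1 _ _ _ hxy h1) (fun w => ?_)
  have := hxz w
  simp only [Fm.eval, Bool.or_eq_true, Bool.and_eq_true, Bool.not_eq_true']
  cases h2 : y.eval w <;> simp_all

theorem ltIn_anti_right (h : IsPreferential K) (hxy : ltIn K x y)
    (hzy : ∀ w, z.eval w = true → y.eval w = true) : ltIn K x z := by
  have h1 : (x.disj y, (x.disj y).conj y.neg) ∈ K := h.2.2.2.1 _ _ _ (h.1 _) hxy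
  have h2 : (x.disj y, z.neg) ∈ K := h.right_weakening h1 (fun w => by
    have := hzy w
    cases h3 : z.eval w <;> simp_all [Fm.eval])
  have h3 : (x.disj y, x.disj z) ∈ K := h.right_weakening h1 (fun w => by
    cases h4 : y.eval w <;> simp_all [Fm.eval])
  refine h.cautious_left h3 h2 (fun w => ?_)
  have := hzy w
  cases h4 : z.eval w <;> simp_all [Fm.eval]

theorem ltIn_trans (h : IsPreferential K) (hxy : ltIn K x y) (hyz : ltIn K y z) :
    ltIn K x z := by
  have h1 : ltIn K (x.disj y) z := h.ltIn_mono_left hyz (fun w => by simp +contextual [Fm.eval])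
  have h2 : ltIn K (x.disj z) y := h.ltIn_mono_left hxy (fun w => by simp +contextual [Fm.eval])
  have h3 : ((x.disj y).disj z, y.neg) ∈ K :=
    h.left_equiv h2 (fun w => by simp only [Fm.eval, Bool.or_eq_true]; tauto)
  have h4 : ((x.disj y).disj z, x.disj z) ∈ K :=
    h.right_weakening (h.2.2.2.1 _ _ _ (h.1 _) h3) (fun w => by
      cases h5 : y.eval w <;> simp [Fm.eval, h5])
  exact h.cautious_left h4 h1 (fun w => by simp only [Fm.eval, Bool.or_eq_true]; tauto)

theorem mem_of_ltIn_self (h : IsPreferential K) (hx : ltIn K x x) : (x, y) ∈ K := by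
  have h1 : (x, x.neg) ∈ K := h.left_equiv hx (fun w => by simp [Fm.eval])
  exact h.right_weakening (h.2.2.2.1 _ _ _ (h.1 x) h1) (fun w => by simp [Fm.eval])

end IsPreferential

namespace IsRational

variable {K : CRel V} {x y z : Fm V}

theorem ltIn_or_ltIn (h : IsRational K) (hxy : ltIn K x y) (z : Fm V) :
    ltIn K x z ∨ ltIn K z y := by
  have hp := h.1
  have h1 : ((x.disj z).disj y, y.neg) ∈ K :=
    hp.ltIn_mono_left hxy (fun w => by simp +contextual [Fm.eval])
  by_cases h2 : ((x.disj z).disj y, (z.disj y).neg) ∈ K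
  · left
    have h3 : ((x.disj z).disj y, z.neg) ∈ K :=
      hp.right_weakening h2 (fun w => by simp +contextual [Fm.eval])
    have h4 : ((x.disj z).disj y, x.disj z) ∈ K :=
      hp.right_weakening (hp.2.2.2.1 _ _ _ (hp.1 _) h1) (fun w => by
        cases h5 : y.eval w <;> simp [Fm.eval, h5])
    exact hp.cautious_left h4 h3 (fun w => by simp only [Fm.eval, Bool.or_eq_true]; tauto)
  · right
    by_contra h3
    refine h.2 _ (z.disj y) y.neg (fun h4 => h3 ?_) h2 h1
    exact hp.left_equiv h4 (fun w => by
      simp only [Fm.eval, Bool.or_eq_true, Bool.and_eq_true]; tauto)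

end IsRational

/-- The `<`-comparisons of `K` below `a` persist in every `L` that extends `K` below `a`. -/
theorem ltIn_of_extends_below {K L : CRel V} {a x y : Fm V} (hK : IsPreferential K)
    (hKL : ∀ c, ltIn K c a → ∀ d, (c, d) ∈ K → (c, d) ∈ L)
    (hxa : ltIn K x a) (hxy : ltIn K x y) : ltIn L x y :=
  hKL _ (hK.ltIn_mono_left hxa (fun w => by simp +contextual [Fm.eval])) _ hxy

theorem Pref.irrefl (K : CRel V) : ¬ Pref K K := by
  rintro ⟨⟨a, b, h, -⟩, -⟩
  exact h.2 h.1

theorem Pref.trans {K0 K1 K2 : CRel V} (h0 : IsRational K0) (h1 : IsRational K1)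
    (h2 : IsRational K2) (h01 : Pref K0 K1) (h12 : Pref K1 K2) : Pref K0 K2 := by
  obtain ⟨⟨a, b, hab, hlow⟩, hdef⟩ := h01
  obtain ⟨⟨a', b', hab', hlow'⟩, hdef'⟩ := h12
  refine ⟨?_, ?_⟩
  · have of_below : ∀ x y, (x, y) ∈ K1 \ K0 → ltIn K1 x a' →
        (∀ c, ltIn K0 c x → ltIn K0 c a) →
        ∃ a b, (a, b) ∈ K2 \ K0 ∧
          ∀ c, ltIn K0 c a → ∀ d, (c, d) ∈ K0 → (c, d) ∈ K2 := by
      intro x y hxy hxa' hx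
      refine ⟨x, y, ⟨hlow' x hxa' y hxy.1, hxy.2⟩, fun c hc d hcd => ?_⟩
      have hcx := ltIn_of_extends_below h0.1 hlow (hx c hc) hc
      exact hlow' c (h1.1.ltIn_trans hcx hxa') d (hlow c (hx c hc) d hcd)
    have of_gain : ∀ r e, (r, e) ∈ K1 \ K0 → ltIn K1 r a' →
        ∃ a b, (a, b) ∈ K2 \ K0 ∧
          ∀ c, ltIn K0 c a → ∀ d, (c, d) ∈ K0 → (c, d) ∈ K2 := by
      intro r e hre hra'
      by_cases har : ltIn K0 a r
      · by_cases hra : ltIn K1 r a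
        · refine of_below (r.disj a) a.neg ⟨hra, fun hn => ?_⟩
            (h1.1.ltIn_mono_left hra' (fun w => by simp +contextual [Fm.eval]))
            (fun c hc => h0.1.ltIn_anti_right hc (fun w => by simp +contextual [Fm.eval]))
          exact hab.2 (h0.1.mem_of_ltIn_self (h0.1.ltIn_trans har hn))
        · exact of_below a b hab ((h1.ltIn_or_ltIn hra' a).resolve_left hra) (fun _ h => h)
      · exact of_below r e hre hra' (fun c hc => (h0.ltIn_or_ltIn hc a).resolve_right har)
    by_cases haa' : ltIn K1 a a'
    · exact of_gain a b hab haa'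
    by_cases hK0 : (a', b') ∈ K0
    · obtain ⟨r, e, hre, hr⟩ := hdef a' b' ⟨hK0, hab'.2⟩
      exact of_gain r e hre hr
    by_cases hlt : ltIn K0 a a'
    · obtain ⟨r, e, hre, hr⟩ := hdef (a.disj a') a'.neg ⟨hlt, haa'⟩
      exact of_gain r e hre
        (h1.1.ltIn_anti_right hr (fun w => by simp +contextual [Fm.eval]))
    · refine ⟨a', b', ⟨hab'.1, hK0⟩, fun c hc d hcd => ?_⟩
      have hca := (h0.ltIn_or_ltIn hc a).resolve_right hlt
      exact hlow' c (ltIn_of_extends_below h0.1 hlow hca hc) d (hlow c hca d hcd)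
  · intro c d hcd
    by_contra hno
    have hsub : ∀ r, ltIn K2 r c → ∀ e, (r, e) ∈ K2 → (r, e) ∈ K0 := by
      intro r hr e hre
      by_contra hn
      exact hno ⟨r, e, ⟨hre, hn⟩, hr⟩
    have not_below : ∀ r e, (r, e) ∈ K2 \ K1 → ltIn K2 r c → ¬ ltIn K2 r a := by
      intro r e hre hrc hra
      have hra0 := ltIn_of_extends_below h2.1 hsub hrc hra
      exact hre.2 (hlow r hra0 e (hsub r hrc e hre.1))
    have hno' : ∀ r e, (r, e) ∈ K2 \ K1 → ¬ ltIn K2 r c := by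
      intro r e hre hrc
      have hac : ltIn K2 a c := (h2.ltIn_or_ltIn hrc a).resolve_left (not_below r e hre hrc)
      have hab2 : (a, b) ∉ K2 := fun hm => hab.2 (hsub a hac b hm)
      obtain ⟨s, f, hsf, hs⟩ := hdef' a b ⟨hab.1, hab2⟩
      exact not_below s f hsf (h2.1.ltIn_trans hs hac) hs
    by_cases hcd1 : (c, d) ∈ K1
    · obtain ⟨r, e, hre, hr⟩ := hdef' c d ⟨hcd1, hcd.2⟩
      exact hno' r e hre hr
    · obtain ⟨r, e, hre, hr⟩ := hdef c d ⟨hcd.1, hcd1⟩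
      by_cases hrc : ltIn K2 r c
      · have hre2 : (r, e) ∉ K2 := fun hm => hre.2 (hsub r hrc e hm)
        obtain ⟨s, f, hsf, hs⟩ := hdef' r e ⟨hre.1, hre2⟩
        exact hno' s f hsf (h2.1.ltIn_trans hs hrc)
      · obtain ⟨s, f, hsf, hs⟩ := hdef' (r.disj c) c.neg ⟨hr, hrc⟩
        exact hno' s f hsf
          (h2.1.ltIn_anti_right hs (fun w => by simp +contextual [Fm.eval]))

/-- The preference relation between rational consequence relations is
irreflexive and transitive. -/
theorem stmt15 (V : Type) :
    (∀ K : CRel V, IsRational K → ¬ Pref K K) ∧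
    (∀ K0 K1 K2 : CRel V, IsRational K0 → IsRational K1 → IsRational K2 →
      Pref K0 K1 → Pref K1 K2 → Pref K0 K2) :=
  ⟨fun K _ => Pref.irrefl K, fun _ _ _ h0 h1 h2 => Pref.trans h0 h1 h2⟩
end

section
/- If the rational closure of a knowledge base K exists, then it contains an assertion of the form α |~ false only if that assertion is in the preferential closure K^p. -/
variable {V : Type}

namespace IsPreferential

variable {A : CRel V}

theorem lle (h : IsPreferential A) {a b c : Fm V}
    (hab : ∀ w, a.eval w = b.eval w) (hac : (a, c) ∈ A) : (b, c) ∈ A :=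
  h.2.1 a b c (fun w => by simp [Fm.eval, hab w]) hac

theorem weaken (h : IsPreferential A) {a b c : Fm V}
    (hab : ∀ w, a.eval w = true → b.eval w = true) (hca : (c, a) ∈ A) : (c, b) ∈ A :=
  h.2.2.1 a b c (fun w => by
    have := hab w
    cases ha : a.eval w <;> simp_all [Fm.eval]) hca

theorem exFalso (h : IsPreferential A) {a : Fm V} (c : Fm V) (ha : (a, Fm.fls) ∈ A) :
    (a, c) ∈ A :=
  h.weaken (fun w hw => by simp [Fm.eval] at hw) ha

/-- Inconsistency passes to classically stronger formulas. -/
theorem inconsistent_of_imp (h : IsPreferential A) {a c : Fm V}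
    (hac : ∀ w, a.eval w = true → c.eval w = true) (hc : (c, Fm.fls) ∈ A) :
    (a, Fm.fls) ∈ A := by
  refine h.lle (a := c.conj a) (fun w => ?_) (h.2.2.2.2.2 c a _ (h.exFalso a hc) hc)
  have := hac w
  cases ha : a.eval w <;> simp_all [Fm.eval]

/-- The conditionalization rule: `α ∧ β |~ γ` yields `α |~ β → γ`. -/
theorem conditionalize (h : IsPreferential A) {a b c : Fm V} (habc : (a.conj b, c) ∈ A) :
    (a, b.impl c) ∈ A := by
  have h1 : (a.conj b, b.impl c) ∈ A :=
    h.weaken (fun w hw => by simp [Fm.eval, hw]) habc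
  have h2 : (a.conj b.neg, b.impl c) ∈ A :=
    h.weaken (fun w hw => by simp [Fm.eval] at hw ⊢; simp [hw.2]) (h.1 (a.conj b.neg))
  refine h.lle (fun w => ?_) (h.2.2.2.2.1 _ _ _ h1 h2)
  cases ha : a.eval w <;> cases hb : b.eval w <;> simp [Fm.eval, ha, hb]

theorem neg_of_inconsistent (h : IsPreferential A) {a b : Fm V}
    (hab : (a.conj b, Fm.fls) ∈ A) : (a, b.neg) ∈ A :=
  h.weaken (fun w hw => by simpa [Fm.eval] using hw) (h.conditionalize hab)

theorem inconsistent_of_cut (h : IsPreferential A) {a b : Fm V} (hb : (a, b) ∈ A)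
    (hab : (a.conj b, Fm.fls) ∈ A) : (a, Fm.fls) ∈ A :=
  h.weaken (fun w hw => by simp [Fm.eval] at hw)
    (h.2.2.2.1 _ _ _ hb (h.neg_of_inconsistent hab))

end IsPreferential

/-- The relation that follows `A` on antecedents consistent for `A`, and `B` on the others:
semantically, a ranked model of `B` placed above a ranked model of `A`. -/
def CRel.stack (A B : CRel V) : CRel V :=
  {p | ((p.1, Fm.fls) ∈ A → p ∈ B) ∧ ((p.1, Fm.fls) ∉ A → p ∈ A)}

theorem IsRational.stack {A B : CRel V} (hA : IsRational A) (hB : IsRational B) :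
    IsRational (A.stack B) := by
  obtain ⟨pA, rA⟩ := hA
  obtain ⟨pB, rB⟩ := hB
  have conj_inc : ∀ {a : Fm V} (b : Fm V), (a, Fm.fls) ∈ A → (a.conj b, Fm.fls) ∈ A :=
    fun b ha => pA.inconsistent_of_imp
      (fun w hw => by simp only [Fm.eval, Bool.and_eq_true] at hw; exact hw.1) ha
  refine ⟨⟨fun a => ⟨fun _ => pB.1 a, fun _ => pA.1 a⟩, ?_, ?_, ?_, ?_, ?_⟩, ?_⟩
  · rintro a b c hab ⟨h1, h2⟩
    have e : ∀ w, a.eval w = b.eval w := fun w => by simpa [Fm.eval] using hab w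
    exact ⟨fun hb => pB.lle e (h1 (pA.lle (fun w => (e w).symm) hb)),
      fun hb => pA.lle e (h2 fun ha => hb (pA.lle e ha))⟩
  · rintro a b c hab ⟨h1, h2⟩
    exact ⟨fun hc => pB.2.2.1 a b c hab (h1 hc), fun hc => pA.2.2.1 a b c hab (h2 hc)⟩
  · rintro a b c ⟨h1, h2⟩ ⟨h3, h4⟩
    exact ⟨fun ha => pB.2.2.2.1 _ _ _ (h1 ha) (h3 ha),
      fun ha => pA.2.2.2.1 _ _ _ (h2 ha) (h4 ha)⟩
  · rintro a b c ⟨h1, h2⟩ ⟨h3, h4⟩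
    refine ⟨fun h => ?_, fun _ => ?_⟩
    · exact pB.2.2.2.2.1 _ _ _
        (h1 (pA.inconsistent_of_imp (fun w hw => by simp [Fm.eval, hw]) h))
        (h3 (pA.inconsistent_of_imp (fun w hw => by simp [Fm.eval, hw]) h))
    · refine pA.2.2.2.2.1 _ _ _ ?_ ?_
      · by_cases ha : (a, Fm.fls) ∈ A
        exacts [pA.exFalso c ha, h2 ha]
      · by_cases hb : (b, Fm.fls) ∈ A
        exacts [pA.exFalso c hb, h4 hb]
  · rintro a b c ⟨h1, h2⟩ ⟨h3, h4⟩
    by_cases ha : (a, Fm.fls) ∈ A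
    · exact ⟨fun _ => pB.2.2.2.2.2 _ _ _ (h1 ha) (h3 ha), fun hab => absurd (conj_inc b ha) hab⟩
    · exact ⟨fun hab => absurd (pA.inconsistent_of_cut (h2 ha) hab) ha,
        fun _ => pA.2.2.2.2.2 _ _ _ (h2 ha) (h4 ha)⟩
  · rintro a b c habc hab ⟨h1, h2⟩
    by_cases ha : (a, Fm.fls) ∈ A
    · refine rB a b c (fun h => habc ?_) (fun h => hab ?_) (h1 ha)
      exacts [⟨fun _ => h, fun h' => absurd (conj_inc b ha) h'⟩,
        ⟨fun _ => h, fun h' => absurd ha h'⟩]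
    · have hn : (a, b.neg) ∉ A := fun h => hab ⟨fun h' => absurd h' ha, fun _ => h⟩
      refine rA a b c (fun h => habc ⟨fun h' => ?_, fun _ => h⟩) hn (h2 ha)
      exact absurd (pA.neg_of_inconsistent h') hn

/-- The consequence relation of the one-state model labeled by `w`. -/
def CRel.single (w : V → Bool) : CRel V := {p | p.1.eval w = true → p.2.eval w = true}

theorem CRel.isRational_single (w : V → Bool) : IsRational (CRel.single w) := by
  refine ⟨⟨fun _ => id, ?_, ?_, ?_, ?_, ?_⟩, ?_⟩
  · intro a b c h
    have := h w
    simp_all [CRel.single, Fm.eval]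
  · intro a b c h
    have := h w
    simp only [CRel.single, Fm.eval, Set.mem_ofPred_eq] at *
    grind
  all_goals
    intro a b c
    simp only [CRel.single, Fm.eval, Set.mem_ofPred_eq]
    grind

theorem exists_disj_antecedents (K : Finset (Fm V × Fm V)) :
    ∃ g : Fm V, ∀ w, g.eval w = true ↔ ∃ p ∈ K, p.1.eval w = true := by
  classical
  induction K using Finset.induction_on with
  | empty => exact ⟨Fm.fls, fun w => by simp [Fm.eval]⟩
  | insert p K _ ih =>
    obtain ⟨g, hg⟩ := ih
    exact ⟨p.1.disj g, fun w => by
      rw [Finset.exists_mem_insert, ← hg]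
      simp [Fm.eval]⟩

/-- A finite knowledge base has a rational extension for which every formula true at a given
state of a preferential model is consistent. -/
theorem PrefModel.exists_isRational_of_finset (W : PrefModel V) (s : W.S) {a : Fm V}
    (ha : a.eval (W.l s) = true) (K : Finset (Fm V × Fm V)) (hK : W.Models ↑K) :
    ∃ C : CRel V, IsRational C ∧ ↑K ⊆ C ∧ (a, Fm.fls) ∉ C := by
  classical
  induction K using Finset.strongInduction with
  | H K ih =>
  by_cases hs : ∃ p ∈ K, p.1.eval (W.l s) = true
  · obtain ⟨g, hg⟩ := exists_disj_antecedents K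
    obtain ⟨t, ht⟩ : ∃ t, MinIn W.lt {t | g.eval (W.l t) = true} t := by
      rcases W.smooth g s ((hg _).2 hs) with h | ⟨t, h, -⟩
      exacts [⟨s, h⟩, ⟨t, h⟩]
    have hmat : ∀ p ∈ K, p.1.eval (W.l t) = true → p.2.eval (W.l t) = true := fun p hp hpt =>
      hK p hp t ⟨hpt, fun u hu => ht.2 u ((hg _).2 ⟨p, hp, hu⟩)⟩
    obtain ⟨C, hC, hKC, haC⟩ := ih (K.filter fun p => ¬ p.1.eval (W.l t) = true)
      (by
        obtain ⟨p, hp, hpt⟩ := (hg _).1 ht.1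
        exact Finset.filter_ssubset.2 ⟨p, hp, not_not.2 hpt⟩)
      (fun p hp => hK p (Finset.mem_of_mem_filter p hp))
    refine ⟨(CRel.single (W.l t)).stack C, (CRel.isRational_single _).stack hC, ?_, ?_⟩
    · refine fun p hp => ⟨fun h => hKC ?_, fun _ => hmat p hp⟩
      exact Finset.mem_coe.2 (Finset.mem_filter.2
        ⟨hp, fun hpt => by simpa [Fm.eval] using h hpt⟩)
    · rintro ⟨h1, h2⟩
      by_cases h : (a, Fm.fls) ∈ CRel.single (W.l t)
      exacts [haC (h1 h), h (h2 h)]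
  · refine ⟨CRel.single (W.l s), CRel.isRational_single _,
      fun p hp hps => absurd ⟨p, hp, hps⟩ hs, fun h => ?_⟩
    simpa [Fm.eval] using h ha

/-- Rational consequence relations are closed under limits along ultrafilters. -/
theorem isRational_ultralimit {ι : Type*} (U : Ultrafilter ι) {f : ι → CRel V}
    (hf : ∀ i, IsRational (f i)) : IsRational {p | ∀ᶠ i in (U : Filter ι), p ∈ f i} := by
  refine ⟨⟨fun a => .of_forall fun i => (hf i).1.1 a, ?_, ?_, ?_, ?_, ?_⟩, ?_⟩
  · exact fun a b c h h1 => h1.mono fun i => (hf i).1.2.1 a b c h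
  · exact fun a b c h h1 => h1.mono fun i => (hf i).1.2.2.1 a b c h
  · exact fun a b c h1 h2 => (h1.and h2).mono fun i h => (hf i).1.2.2.2.1 a b c h.1 h.2
  · exact fun a b c h1 h2 => (h1.and h2).mono fun i h => (hf i).1.2.2.2.2.1 a b c h.1 h.2
  · exact fun a b c h1 h2 => (h1.and h2).mono fun i h => (hf i).1.2.2.2.2.2 a b c h.1 h.2
  · exact fun a b c h1 h2 => Ultrafilter.eventually_not.1
      (((Ultrafilter.eventually_not.2 h1).and (Ultrafilter.eventually_not.2 h2)).mono
        fun i h => (hf i).2 a b c h.1 h.2)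

/-- A formula true at some state of a preferential model of `K` is consistent for some rational
extension of `K`. -/
theorem PrefModel.exists_isRational (W : PrefModel V) (s : W.S) {a : Fm V}
    (ha : a.eval (W.l s) = true) {K : CRel V} (hK : W.Models K) :
    ∃ C : CRel V, IsRational C ∧ K ⊆ C ∧ (a, Fm.fls) ∉ C := by
  have key : ∀ F : Finset K, ∃ C : CRel V,
      IsRational C ∧ (∀ p ∈ F, (p : Fm V × Fm V) ∈ C) ∧ (a, Fm.fls) ∉ C := fun F => by
    obtain ⟨C, hC, hFC, haC⟩ := W.exists_isRational_of_finset s ha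
      (F.map (Function.Embedding.subtype _)) (fun p hp => by
        obtain ⟨q, -, rfl⟩ := Finset.mem_map.1 (Finset.mem_coe.1 hp)
        exact hK q q.2)
    exact ⟨C, hC, fun p hp => hFC (Finset.mem_coe.2 (Finset.mem_map_of_mem _ hp)), haC⟩
  choose f hf hFf haf using key
  let U : Ultrafilter (Finset K) := Ultrafilter.of Filter.atTop
  refine ⟨_, isRational_ultralimit U hf, fun p hp => ?_, ?_⟩
  · exact Ultrafilter.of_le Filter.atTop ((Filter.eventually_ge_atTop {⟨p, hp⟩}).mono
      fun F hF => hFf F ⟨p, hp⟩ (hF (Finset.mem_singleton_self _)))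
  · exact Ultrafilter.eventually_not.1 (.of_forall haf)

/-- The rational closure of K, if it exists, contains α |~ false only if this
assertion is in the preferential closure of K. -/
theorem stmt17 (V : Type) (K C : CRel V) (h : IsRationalClosure K C)
    (a : Fm V) (ha : (a, Fm.fls) ∈ C) : (a, Fm.fls) ∈ PrefClosure K := by
  intro W hW s hs
  exfalso
  obtain ⟨D, hD, hKD, haD⟩ := W.exists_isRational s hs.1 hW
  obtain ⟨hC, hKC, hpref⟩ := h
  have hsub : C.stack D ⊆ C := fun p hp => by
    by_cases hp' : (p.1, Fm.fls) ∈ C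
    exacts [hC.1.exFalso p.2 hp', hp.2 hp']
  have hne : C.stack D ≠ C := fun e => haD ((e.symm ▸ ha : (a, Fm.fls) ∈ C.stack D).1 ha)
  obtain ⟨⟨x, y, hxy, -⟩, -⟩ := hpref _ (hC.stack hD)
    (fun p hp => ⟨fun _ => hKD hp, fun _ => hKC hp⟩) hne
  exact hxy.2 (hsub hxy.1)
end
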